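/- Let F be a subfield of ℝ and let S = F^d ⊆ ℝ^d. Then h(S) = d+1: (i) for every finite family F₁, …, F_m of convex subsets of ℝ^d, if every subfamily of at most d+1 of the sets has a common point belonging to F^d, then all m sets have a common point belonging to F^d; and (ii) there exist d+1 convex subsets of ℝ^d such that any d of them have a common point belonging to F^d but all d+1 together do not. -/

import Mathlib

def HellyLe {d : ℕ} (S : Set (EuclideanSpace ℝ (Fin d))) (n : ℕ) : Prop :=
  ∀ (m : ℕ) (F : Fin m → Set (EuclideanSpace ℝ (Fin d))),
    (∀ i, Convex ℝ (F i)) →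
    (∀ I : Finset (Fin m), I.card ≤ n → (S ∩ ⋂ i ∈ I, F i).Nonempty) →
    (S ∩ ⋂ i, F i).Nonempty

/-- The set `F^d ⊆ ℝ^d` of points all of whose coordinates lie in the subfield `F` of `ℝ`. -/
def fieldGrid (d : ℕ) (F : Subfield ℝ) : Set (EuclideanSpace ℝ (Fin d)) :=
  {x | ∀ i, x i ∈ F}

/-- The `S`-Helly number of `F^d` is at most `d + 1`: Helly's theorem holds over the ordered field
`F` itself. -/
theorem hellyLe_fieldGrid (d : ℕ) (F : Subfield ℝ) : HellyLe (fieldGrid d F) (d + 1) := by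
  intro m K hK hI
  let φ : (Fin d → F) → EuclideanSpace ℝ (Fin d) := fun v ↦ WithLp.toLp 2 fun i ↦ (v i : ℝ)
  have key : (⋂ i ∈ (Finset.univ : Finset (Fin m)), φ ⁻¹' K i).Nonempty := by
    refine Convex.helly_theorem' (𝕜 := F) (fun i _ ↦ ?_) fun I _ hcard ↦ ?_
    · intro x hx y hy a b ha hb hab
      have hφ : φ (a • x + b • y) = (a : ℝ) • φ x + (b : ℝ) • φ y := by
        ext j
        simp [φ]
      rw [Set.mem_preimage, hφ]
      exact hK i hx hy (by exact_mod_cast ha) (by exact_mod_cast hb) (by exact_mod_cast hab)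
    · obtain ⟨x, hxF, hx⟩ := hI I (by simpa using hcard)
      refine ⟨fun i ↦ ⟨x i, hxF i⟩, ?_⟩
      simpa [φ] using hx
  obtain ⟨v, hv⟩ := key
  exact ⟨φ v, fun i ↦ (v i).2, by simpa using hv⟩

/-- The `d + 1` half-spaces `∑ j, x j ≥ 1` and `x i ≤ 0`: any `d` of them share a point of `F^d`,
but all of them have empty intersection. -/
theorem exists_convex_family_fieldGrid (d : ℕ) (F : Subfield ℝ) :
    ∃ K : Fin (d + 1) → Set (EuclideanSpace ℝ (Fin d)),
      (∀ i, Convex ℝ (K i)) ∧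
      (∀ i : Fin (d + 1),
        (fieldGrid d F ∩ ⋂ j ∈ ({i}ᶜ : Finset (Fin (d + 1))), K j).Nonempty) ∧
      (fieldGrid d F ∩ ⋂ i, K i) = ∅ := by
  refine ⟨Fin.cons {x | 1 ≤ ∑ j, x j} fun i ↦ {x | x i ≤ 0}, fun i ↦ ?_, fun i ↦ ?_, ?_⟩
  · cases i using Fin.cases with
    | zero =>
      refine convex_halfSpace_ge (f := fun x : EuclideanSpace ℝ (Fin d) ↦ ∑ j, x j) ⟨?_, ?_⟩ 1
      · simp [Finset.sum_add_distrib]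
      · simp [Finset.mul_sum]
    | succ i =>
      exact convex_halfSpace_le (f := fun x : EuclideanSpace ℝ (Fin d) ↦ x i)
        ⟨by simp, by simp⟩ 0
  · cases i using Fin.cases with
    | zero =>
      refine ⟨0, fun i ↦ by simp, ?_⟩
      simp only [Set.mem_iInter]
      intro j hj
      cases j using Fin.cases with
      | zero => simp at hj
      | succ j => simp
    | succ i =>
      refine ⟨EuclideanSpace.single i 1, fun j ↦ ?_, ?_⟩
      · by_cases h : j = i <;> simp [h]
      simp only [Set.mem_iInter]
      intro j hj
      cases j using Fin.cases with
      | zero => simp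
      | succ j =>
        have hji : j ≠ i := by simpa using hj
        simp [hji]
  · refine Set.eq_empty_iff_forall_notMem.2 fun x hx ↦ ?_
    have hx' := Set.mem_iInter.1 hx.2
    have hsum : 1 ≤ ∑ j, x j := hx' 0
    have hle : ∑ j, x j ≤ 0 := Finset.sum_nonpos fun j _ ↦ hx' j.succ
    linarith

/-- For any subfield `F` of `ℝ`, `h(F^d) = d + 1`: (i) `h(F^d) ≤ d + 1` holds, and
(ii) there are `d + 1` convex subsets of `ℝ^d` any `d` of which have a common point of `F^d`
while all `d + 1` together contain none, so `h(F^d) ≤ d` fails. -/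
theorem subfield_grid_helly (d : ℕ) (F : Subfield ℝ) :
    HellyLe (fieldGrid d F) (d + 1) ∧
    (∃ K : Fin (d + 1) → Set (EuclideanSpace ℝ (Fin d)),
      (∀ i, Convex ℝ (K i)) ∧
      (∀ i : Fin (d + 1),
        (fieldGrid d F ∩ ⋂ j ∈ ({i}ᶜ : Finset (Fin (d + 1))), K j).Nonempty) ∧
      (fieldGrid d F ∩ ⋂ i, K i) = ∅) ∧
    ¬ HellyLe (fieldGrid d F) d := by
  obtain ⟨K, hconv, hinter, hempty⟩ := exists_convex_family_fieldGrid d F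
  refine ⟨hellyLe_fieldGrid d F, ⟨K, hconv, hinter, hempty⟩, fun h ↦ ?_⟩
  refine (h (d + 1) K hconv fun I hI ↦ ?_).ne_empty hempty
  obtain ⟨i, hi⟩ : ∃ i, i ∉ I := by
    by_contra! hall
    have : I.card = d + 1 := by simp [Finset.eq_univ_of_forall hall]
    omega
  refine (hinter i).mono (Set.inter_subset_inter_right _ (Set.biInter_mono ?_ fun _ _ ↦ le_rfl))
  intro j hj
  simpa using fun hji : j = i ↦ hi (hji ▸ hj)
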